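/- arXiv:2510.16642 — 5 statements merged into one kernel-verified Lean document; each statement's English description precedes it below -/
import Mathlib

section
/- Let V be a C¹ vector field on ℝⁿ and f : ℝⁿ → ℝ a C² function. Write Vg for the derivative of a function g along V, i.e. (Vg)(x) = Dg(x)[V(x)], and set Ω := {x : (Vf)(x) = 0 and (V(Vf))(x) = 0}. Assume that (V(Vf))(x) + ((Vf)(x))² ≥ 0 for every x ∈ ℝⁿ, with equality if and only if x ∈ Ω (so in particular, at every point where (Vf)(x) = 0 one has (V(Vf))(x) ≥ 0, with equality exactly on Ω). If γ : [0,∞) → ℝⁿ is an integral curve of V (γ'(s) = V(γ(s)) for all s ≥ 0) whose image is contained in a compact set K ⊆ ℝⁿ, then γ(t) tends to Ω as t → +∞: for every ε > 0 there exists T ≥ 0 such that for all t ≥ T there is a point y ∈ Ω with ‖γ(t) − y‖ < ε. -/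
/-- Escape-function proposition (Appendix B): an integral curve of a C¹ vector
field `V` that stays in a compact set forever tends to the degenerate locus
`Ω = {Vf = 0, V(Vf) = 0}` of a function `f` whose escape quantity
`V(Vf) + (Vf)²` is nonnegative with zero set exactly `Ω`. -/
theorem escape_function_trapping {n : ℕ}
    (V : EuclideanSpace ℝ (Fin n) → EuclideanSpace ℝ (Fin n))
    (f : EuclideanSpace ℝ (Fin n) → ℝ)
    (hV : ContDiff ℝ 1 V) (hf : ContDiff ℝ 2 f)
    (Vf VVf : EuclideanSpace ℝ (Fin n) → ℝ)
    (hVf : ∀ x, Vf x = fderiv ℝ f x (V x))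
    (hVVf : ∀ x, VVf x = fderiv ℝ Vf x (V x))
    (Ω : Set (EuclideanSpace ℝ (Fin n)))
    (hΩ : Ω = {x | Vf x = 0 ∧ VVf x = 0})
    (hpos : ∀ x, 0 ≤ VVf x + (Vf x) ^ 2)
    (hzero : ∀ x, VVf x + (Vf x) ^ 2 = 0 ↔ x ∈ Ω)
    (γ : ℝ → EuclideanSpace ℝ (Fin n))
    (hγ : ∀ s, 0 ≤ s → HasDerivAt γ (V (γ s)) s)
    (K : Set (EuclideanSpace ℝ (Fin n))) (hK : IsCompact K)
    (hγK : ∀ s, 0 ≤ s → γ s ∈ K) :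
    ∀ ε > 0, ∃ T, 0 ≤ T ∧ ∀ t, T ≤ t → ∃ y ∈ Ω, ‖γ t - y‖ < ε := by
  have hVfC : ContDiff ℝ 1 Vf := by
    have h1 : ContDiff ℝ 1 (fun x => fderiv ℝ f x (V x)) :=
      (hf.fderiv_right (m := 1) (by norm_num)).clm_apply hV
    rwa [show Vf = fun x => fderiv ℝ f x (V x) from funext hVf]
  have hVVfC : Continuous VVf := by
    rw [show VVf = fun x => fderiv ℝ Vf x (V x) from funext hVVf]
    exact (hVfC.continuous_fderiv (by norm_num)).clm_apply hV.continuous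
  have hfc : Continuous f := hf.continuous
  have hVfc : Continuous Vf := hVfC.continuous
  have hVc : Continuous V := hV.continuous
  let G : EuclideanSpace ℝ (Fin n) → ℝ := fun x => (VVf x + (Vf x) ^ 2) * Real.exp (f x)
  have hGc : Continuous G := by fun_prop
  have hG0 : ∀ x, 0 ≤ G x := fun x => mul_nonneg (hpos x) (Real.exp_pos _).le
  let φ : ℝ → ℝ := fun s => Vf (γ s) * Real.exp (f (γ s))
  have hφ : ∀ s, 0 ≤ s → HasDerivAt φ (G (γ s)) s := by
    intro s hs
    have h1 : HasDerivAt (fun s => Vf (γ s)) (VVf (γ s)) s := by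
      rw [hVVf]
      exact ((hVfC.differentiable (by norm_num)) (γ s)).hasFDerivAt.comp_hasDerivAt s (hγ s hs)
    have h2 : HasDerivAt (fun s => f (γ s)) (Vf (γ s)) s := by
      rw [hVf]
      exact ((hf.differentiable (by norm_num)) (γ s)).hasFDerivAt.comp_hasDerivAt s (hγ s hs)
    refine (h1.mul h2.exp).congr_deriv ?_
    simp only [G]
    ring
  have hgrow : ∀ c a b, 0 ≤ a → a ≤ b → (∀ s, a ≤ s → s ≤ b → c ≤ G (γ s)) →
      c * (b - a) ≤ φ b - φ a := by
    intro c a b ha hab hc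
    refine Convex.mul_sub_le_image_sub_of_le_deriv (convex_Icc a b) ?_ ?_ ?_ a
      (Set.left_mem_Icc.2 hab) b (Set.right_mem_Icc.2 hab) hab
    · exact fun s hs => (hφ s (ha.trans hs.1)).continuousAt.continuousWithinAt
    · intro s hs
      have hs := interior_subset hs
      exact (hφ s (ha.trans hs.1)).differentiableAt.differentiableWithinAt
    · intro s hs
      have hs := interior_subset hs
      rw [(hφ s (ha.trans hs.1)).deriv]
      exact hc s hs.1 hs.2
  obtain ⟨M, hM⟩ := hK.exists_bound_of_continuousOn
    (f := fun x => Vf x * Real.exp (f x)) (by fun_prop)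
  obtain ⟨L, hL⟩ := hK.exists_bound_of_continuousOn (f := V) hVc.continuousOn
  have hL0 : 0 ≤ L := (norm_nonneg _).trans (hL _ (hγK 0 le_rfl))
  intro ε hε
  let S : Set (EuclideanSpace ℝ (Fin n)) := {x | ∀ y ∈ Ω, ε / 2 ≤ ‖x - y‖}
  have hS : IsClosed S := by
    have : S = ⋂ y ∈ Ω, {x | ε / 2 ≤ ‖x - y‖} := by ext; simp [S]
    rw [this]
    exact isClosed_biInter fun y _ => isClosed_le (by fun_prop) (by fun_prop)
  have hKS : IsCompact (K ∩ S) := hK.inter_right hS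
  obtain ⟨c, hc, hcG⟩ : ∃ c : ℝ, 0 < c ∧ ∀ x ∈ K ∩ S, c ≤ G x := by
    rcases (K ∩ S).eq_empty_or_nonempty with he | hne
    · exact ⟨1, one_pos, by simp [he]⟩
    · obtain ⟨x, hx, hmin⟩ := hKS.exists_isMinOn hne hGc.continuousOn
      refine ⟨G x, lt_of_le_of_ne (hG0 x) ?_, fun y hy => hmin hy⟩
      intro h0
      have h1 : VVf x + (Vf x) ^ 2 = 0 :=
        (mul_eq_zero.1 h0.symm).resolve_right (Real.exp_pos _).ne'
      have h2 := hx.2 x ((hzero x).1 h1)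
      simp at h2
      linarith
  let δ : ℝ := ε / (2 * (L + 1))
  have hδ : 0 < δ := by positivity
  have hLδ : L * δ ≤ ε / 2 := by
    have : (L + 1) * δ = ε / 2 := by
      simp only [δ]
      field_simp
    nlinarith
  -- near-supremum of the monotone bounded function
  have hbdd : BddAbove (φ '' Set.Ici 0) := by
    refine ⟨M, ?_⟩
    rintro _ ⟨s, hs, rfl⟩
    exact (le_abs_self _).trans (hM _ (hγK s hs))
  have hne : (φ '' Set.Ici 0).Nonempty := ⟨φ 0, 0, Set.mem_Ici.2 le_rfl, rfl⟩
  obtain ⟨_, ⟨T, hT, rfl⟩, hTs⟩ := exists_lt_of_lt_csSup hne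
    (show sSup (φ '' Set.Ici 0) - c * δ < sSup (φ '' Set.Ici 0) by
      have := mul_pos hc hδ
      linarith)
  have hT : 0 ≤ T := hT
  refine ⟨T, hT, fun t ht => ?_⟩
  by_contra! hcon
  have ht0 : 0 ≤ t := hT.trans ht
  have h1 := hgrow 0 T t hT ht (fun s _ _ => hG0 _)
  have h2 := hgrow c t (t + δ) ht0 (by linarith) (by
    intro s hs1 hs2
    refine hcG _ ⟨hγK s (ht0.trans hs1), fun y hy => ?_⟩
    have h3 : ‖γ s - γ t‖ ≤ L * (s - t) :=
      norm_image_sub_le_of_norm_deriv_le_segment' (f := γ) (f' := fun s => V (γ s))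
        (a := t) (b := s) (fun r hr => (hγ r (ht0.trans hr.1)).hasDerivWithinAt)
        (fun r hr => hL _ (hγK r (ht0.trans hr.1))) s (Set.right_mem_Icc.2 hs1)
    have h4 : L * (s - t) ≤ L * δ := mul_le_mul_of_nonneg_left (by linarith) hL0
    have h5 := hcon y hy
    have h6 : ‖γ t - y‖ ≤ ‖γ t - γ s‖ + ‖γ s - y‖ := norm_sub_le_norm_sub_add_norm_sub _ _ _
    rw [norm_sub_rev (γ t) (γ s)] at h6
    linarith)
  have h3 : φ (t + δ) ≤ sSup (φ '' Set.Ici 0) :=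
    le_csSup hbdd ⟨t + δ, Set.mem_Ici.2 (by linarith), rfl⟩
  rw [add_sub_cancel_left] at h2
  linarith
end

section
/- Suppose h ≥ 0, the solution is defined on [0,∞), the null constraint ξt(s)² = ξr(s)² + h/(1 + r(s)² + t(s)²) holds for all s ≥ 0, and moreover either h > 0 or (ξt(0), ξr(0)) ≠ (0,0). Then the projected curve s ↦ (t(s), r(s)) leaves every compact subset of ℝ²: sup_{s ≥ 0} (t(s)² + r(s)²) = ∞. -/
/-- Null geodesics of the scattering spacetime `−dt² + dr² + (1+r²+t²)dω²`
escape to infinity: if `h ≥ 0`, the null constraint holds for all `s ≥ 0`, and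
either `h > 0` or `(ξt(0), ξr(0)) ≠ (0,0)`, then `sup_{s ≥ 0} (t² + r²) = ∞`. -/
theorem null_geodesics_escape
    (h : ℝ) (hh : 0 ≤ h)
    (t r xt xr : ℝ → ℝ)
    (ht : ∀ s ∈ Set.Ici (0 : ℝ), HasDerivWithinAt t (-2 * xt s) (Set.Ici 0) s)
    (hr : ∀ s ∈ Set.Ici (0 : ℝ), HasDerivWithinAt r (2 * xr s) (Set.Ici 0) s)
    (hxt : ∀ s ∈ Set.Ici (0 : ℝ),
      HasDerivWithinAt xt (2 * t s * h / (1 + r s ^ 2 + t s ^ 2) ^ 2) (Set.Ici 0) s)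
    (hxr : ∀ s ∈ Set.Ici (0 : ℝ),
      HasDerivWithinAt xr (2 * r s * h / (1 + r s ^ 2 + t s ^ 2) ^ 2) (Set.Ici 0) s)
    (hnull : ∀ s, 0 ≤ s → xt s ^ 2 = xr s ^ 2 + h / (1 + r s ^ 2 + t s ^ 2))
    (hnontriv : 0 < h ∨ (xt 0, xr 0) ≠ ((0 : ℝ), (0 : ℝ))) :
    ∀ M : ℝ, ∃ s, 0 ≤ s ∧ M < t s ^ 2 + r s ^ 2 := by
  intro M
  by_contra hcon
  push Not at hcon
  have hM : 0 ≤ M := le_trans (by positivity) (hcon 0 le_rfl)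
  obtain ⟨c, hc, hcx⟩ : ∃ c : ℝ, 0 < c ∧ ∀ s, 0 ≤ s → c ≤ xt s ^ 2 := by
    rcases hh.lt_or_eq with hpos | h0
    · refine ⟨h / (1 + M), by positivity, fun s hs => ?_⟩
      rw [hnull s hs]
      have h1 : h / (1 + M) ≤ h / (1 + r s ^ 2 + t s ^ 2) := by
        apply div_le_div_of_nonneg_left hh (by positivity)
        linarith [hcon s hs]
      nlinarith [sq_nonneg (xr s)]
    · subst h0
      have hne : xt 0 ≠ 0 := by
        intro hx
        rcases hnontriv with h1 | h1
        · exact lt_irrefl _ h1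
        · have h2 := hnull 0 le_rfl
          rw [hx] at h2
          apply h1
          have h3 : xr 0 ^ 2 = 0 := by simpa using h2.symm
          have h4 : xr 0 = 0 := by simpa using h3
          rw [hx, h4]
      refine ⟨xt 0 ^ 2, by positivity, fun s hs => ?_⟩
      rcases hs.eq_or_lt with rfl | hs
      · exact le_rfl
      obtain ⟨p, hp, hpe⟩ := exists_hasDerivAt_eq_slope xt
        (fun s => 2 * t s * 0 / (1 + r s ^ 2 + t s ^ 2) ^ 2) hs
        (fun x hx => ((hxt x hx.1).continuousWithinAt).mono Set.Icc_subset_Ici_self)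
        (fun x hx => (hxt x hx.1.le).hasDerivAt (Ici_mem_nhds hx.1))
      have h5 : xt s = xt 0 := by
        rw [eq_div_iff (by linarith)] at hpe
        simp at hpe
        linarith
      rw [h5]
  have hS : 0 < M / c + 1 := by positivity
  obtain ⟨p, hp, hpe⟩ := exists_hasDerivAt_eq_slope t (fun s => -2 * xt s) hS
    (fun x hx => ((ht x hx.1).continuousWithinAt).mono Set.Icc_subset_Ici_self)
    (fun x hx => (ht x hx.1.le).hasDerivAt (Ici_mem_nhds hx.1))
  have h1 := hcx p hp.1.le
  have h2 := hcon _ hS.le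
  have h3 := hcon 0 le_rfl
  have hcM : c * (M / c) = M := by field_simp
  obtain ⟨S, hSdef⟩ : ∃ S, S = M / c + 1 := ⟨_, rfl⟩
  have hcS : c * S = M + c := by rw [hSdef, mul_add, hcM, mul_one]
  have hS1 : 1 ≤ S := by
    rw [hSdef]
    have : 0 ≤ M / c := by positivity
    linarith
  rw [← hSdef] at hpe h2
  rw [eq_div_iff (by linarith), sub_zero] at hpe
  have h4 : 4 * (xt p ^ 2 * S ^ 2) = (t S - t 0) ^ 2 := by
    rw [← hpe]; ring
  have h5 : c * S ^ 2 ≤ xt p ^ 2 * S ^ 2 := mul_le_mul_of_nonneg_right h1 (sq_nonneg S)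
  have h6 : M + c ≤ c * S ^ 2 := by
    have : c * S ^ 2 = (M + c) * S := by rw [← hcS]; ring
    rw [this]
    exact le_mul_of_one_le_right (by linarith) hS1
  nlinarith [sq_nonneg (t S + t 0), sq_nonneg (r S), sq_nonneg (r 0)]
end

section
/- Suppose h > 0, the interval of definition is I, and the null constraint ξt(s)² = ξr(s)² + h/(1 + r(s)² + t(s)²) holds for all s ∈ I. If the projected curve (t, r) remains in a bounded subset of ℝ², then ξt² is bounded below by a positive constant on I; in any case ξt has no zeros on I, hence has constant sign, and consequently t is strictly monotone on I. -/
/-- Key sub-claim for escape of null geodesics with `h > 0`: under the null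
constraint, if the projected curve `(t, r)` stays bounded then `ξt²` is bounded
below by a positive constant; in any case `ξt` never vanishes, has constant
sign, and `t` is strictly monotone. -/
theorem xt_no_zeros_and_t_monotone
    (h : ℝ) (hh : 0 < h) (I : Set ℝ) (hI : I.OrdConnected)
    (t r xt xr : ℝ → ℝ)
    (ht : ∀ s ∈ I, HasDerivWithinAt t (-2 * xt s) I s)
    (hr : ∀ s ∈ I, HasDerivWithinAt r (2 * xr s) I s)
    (hxt : ∀ s ∈ I, HasDerivWithinAt xt (2 * t s * h / (1 + r s ^ 2 + t s ^ 2) ^ 2) I s)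
    (hxr : ∀ s ∈ I, HasDerivWithinAt xr (2 * r s * h / (1 + r s ^ 2 + t s ^ 2) ^ 2) I s)
    (hnull : ∀ s ∈ I, xt s ^ 2 = xr s ^ 2 + h / (1 + r s ^ 2 + t s ^ 2)) :
    ((∃ C : ℝ, ∀ s ∈ I, t s ^ 2 + r s ^ 2 ≤ C) →
        ∃ c > 0, ∀ s ∈ I, c ≤ xt s ^ 2) ∧
      (∀ s ∈ I, xt s ≠ 0) ∧
      ((∀ s ∈ I, 0 < xt s) ∨ (∀ s ∈ I, xt s < 0)) ∧
      (StrictMonoOn t I ∨ StrictAntiOn t I) := by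
  have hpos : ∀ s ∈ I, 0 < xt s ^ 2 := by
    intro s hs
    rw [hnull s hs]
    positivity
  have hne : ∀ s ∈ I, xt s ≠ 0 := by
    intro s hs h0
    have := hpos s hs
    simp [h0] at this
  have hc : ContinuousOn xt I := fun s hs => (hxt s hs).continuousWithinAt
  have hct : ContinuousOn t I := fun s hs => (ht s hs).continuousWithinAt
  have hsign : (∀ s ∈ I, 0 < xt s) ∨ (∀ s ∈ I, xt s < 0) := by
    by_contra hcon
    push Not at hcon
    obtain ⟨⟨a, ha, hxa⟩, ⟨b, hb, hxb⟩⟩ := hcon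
    obtain ⟨z, hz, hz0⟩ := hI.isPreconnected.intermediate_value ha hb hc ⟨hxa, hxb⟩
    exact hne z hz hz0
  refine ⟨?_, hne, hsign, ?_⟩
  · rintro ⟨C, hC⟩
    refine ⟨h / (1 + |C|), by positivity, fun s hs => ?_⟩
    rw [hnull s hs]
    have h1 : h / (1 + |C|) ≤ h / (1 + r s ^ 2 + t s ^ 2) := by
      apply div_le_div_of_nonneg_left hh.le (by positivity)
      linarith [hC s hs, le_abs_self C]
    linarith [sq_nonneg (xr s)]
  · rcases hsign with hp | hn
    · right
      refine strictAntiOn_of_hasDerivWithinAt_neg hI.convex hct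
        (fun x hx => (ht x (interior_subset hx)).mono interior_subset) (fun x hx => ?_)
      linarith [hp x (interior_subset hx)]
    · left
      refine strictMonoOn_of_hasDerivWithinAt_pos hI.convex hct
        (fun x hx => (ht x (interior_subset hx)).mono interior_subset) (fun x hx => ?_)
      linarith [hn x (interior_subset hx)]
end

section
/- If a solution of the system on an interval I ⊆ ℝ containing 0 satisfies sin(2θ(0)) = 0 and η(0) = 0, then sin(2θ(s)) = 0 and η(s) = 0 for all s ∈ I; in fact θ(s) = θ(0) for all s ∈ I. (Thus the trapped set Γ = {sin(2θ) = 0, η = 0} is invariant under the flow.) -/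
open Real

theorem th_aux (f g : ℝ → ℝ) (f' g' : ℝ → ℝ) (K : ℝ)
    (hf : ∀ t ∈ Set.Icc (0:ℝ) 1, HasDerivWithinAt f (f' t) (Set.Icc 0 1) t)
    (hg : ∀ t ∈ Set.Icc (0:ℝ) 1, HasDerivWithinAt g (g' t) (Set.Icc 0 1) t)
    (bf : ∀ t ∈ Set.Icc (0:ℝ) 1, |f' t| ≤ K * max |f t| |g t|)
    (bg : ∀ t ∈ Set.Icc (0:ℝ) 1, |g' t| ≤ K * max |f t| |g t|)
    (f0 : f 0 = 0) (g0 : g 0 = 0) : f 1 = 0 ∧ g 1 = 0 := by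
  have key := norm_le_gronwallBound_of_norm_deriv_right_le
    (f := fun t => (f t, g t)) (f' := fun t => (f' t, g' t)) (δ := 0) (K := K) (ε := 0)
    (a := 0) (b := 1)
    (fun t ht => ((hf t ht).prodMk (hg t ht)).continuousWithinAt)
    (fun t ht => ((hf t ⟨ht.1, ht.2.le⟩).prodMk (hg t ⟨ht.1, ht.2.le⟩)).mono_of_mem_nhdsWithin
      (Icc_mem_nhdsGE_of_mem ht))
    (by simp [f0, g0])
    (fun t ht => by
      have h1 := bf t ⟨ht.1, ht.2.le⟩
      have h2 := bg t ⟨ht.1, ht.2.le⟩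
      simpa [Prod.norm_def] using And.intro h1 h2) 1 (by simp)
  simpa [gronwallBound_ε0, Prod.ext_iff] using key

/-- Invariance of the trapped set `Γ = {sin(2θ) = 0, η = 0}` under the rescaled
Hamiltonian flow: a solution starting on `Γ` stays on `Γ`, with `θ` constant. -/
theorem trapped_set_invariant
    (h : ℝ) (I : Set ℝ) (hI : I.OrdConnected) (h0 : (0 : ℝ) ∈ I)
    (tau th sg et : ℝ → ℝ)
    (htau : ∀ s ∈ I, HasDerivWithinAt tau
      (tau s * (cos (2 * th s) * sg s + sin (2 * th s) * et s)) I s)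
    (hth : ∀ s ∈ I, HasDerivWithinAt th
      (-cos (2 * th s) * et s + sin (2 * th s) * sg s) I s)
    (hsg : ∀ s ∈ I, HasDerivWithinAt sg 0 I s)
    (het : ∀ s ∈ I, HasDerivWithinAt et
      (-sin (2 * th s) * et s ^ 2 + sin (2 * th s) * sg s ^ 2
        - 2 * cos (2 * th s) * sg s * et s) I s)
    (hsin0 : sin (2 * th 0) = 0) (het0 : et 0 = 0) :
    ∀ s ∈ I, sin (2 * th s) = 0 ∧ et s = 0 ∧ th s = th 0 := by
  intro s hs
  have hmap : ∀ t ∈ Set.Icc (0:ℝ) 1, s * t ∈ I := by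
    intro t ht
    rcases le_total 0 s with h' | h'
    · exact hI.out h0 hs ⟨mul_nonneg h' ht.1, by nlinarith [ht.2]⟩
    · exact hI.out hs h0 ⟨by nlinarith [ht.2], mul_nonpos_of_nonpos_of_nonneg h' ht.1⟩
  have comp : ∀ (u u' : ℝ → ℝ), (∀ x ∈ I, HasDerivWithinAt u (u' x) I x) →
      ∀ t ∈ Set.Icc (0:ℝ) 1,
        HasDerivWithinAt (fun t => u (s * t)) (u' (s * t) * s) (Set.Icc 0 1) t := by
    intro u u' hu t ht
    have h2 : HasDerivWithinAt (fun t : ℝ => s * t) s (Set.Icc 0 1) t := by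
      simpa using ((hasDerivAt_id t).const_mul s).hasDerivWithinAt
    exact (hu _ (hmap t ht)).comp t h2 hmap
  have cth := comp _ _ hth
  have csg := comp sg (fun _ => 0) hsg
  have cet := comp _ _ het
  obtain ⟨A, hA⟩ := isCompact_Icc.exists_bound_of_continuousOn
    (fun t ht => (csg t ht).continuousWithinAt)
  obtain ⟨B, hB⟩ := isCompact_Icc.exists_bound_of_continuousOn
    (fun t ht => (cet t ht).continuousWithinAt)
  simp only [Real.norm_eq_abs] at hA hB
  have z : (0:ℝ) ∈ Set.Icc (0:ℝ) 1 := by simp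
  have hA0 : 0 ≤ A := (abs_nonneg _).trans (hA 0 z)
  have hB0 : 0 ≤ B := (abs_nonneg _).trans (hB 0 z)
  have hsin : ∀ x, |sin (2 * th x)| ≤ 2 * |th x - th 0| := by
    intro x
    have e : sin (2 * th x) = sin (2 * (th x - th 0)) * cos (2 * th 0) := by
      have : 2 * th x = 2 * (th x - th 0) + 2 * th 0 := by ring
      rw [this, sin_add, hsin0]; simp
    rw [e, abs_mul]
    calc _ ≤ |sin (2 * (th x - th 0))| * 1 := by
          gcongr; exact abs_cos_le_one _
      _ ≤ |2 * (th x - th 0)| := by rw [mul_one]; exact abs_sin_le_abs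
      _ = _ := by rw [abs_mul]; simp
  have main := th_aux (fun t => th (s * t) - th 0) (fun t => et (s * t)) _ _
    ((1 + 2 * A + 2 * B ^ 2 + 2 * A ^ 2) * |s|)
    (fun t ht => (cth t ht).sub_const _) cet ?_ ?_ (by simp) (by simpa using het0)
  · simp only [mul_one] at main
    have e : th s = th 0 := by linarith [main.1]
    exact ⟨by rw [e, hsin0], main.2, e⟩
  all_goals
    intro t ht
    have a := hA t ht
    have b := hB t ht
    have sn := hsin (s * t)
    have c := abs_cos_le_one (2 * th (s * t))
    rw [abs_mul, mul_right_comm _ |s|]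
    refine mul_le_mul_of_nonneg_right ?_ (abs_nonneg s)
    beta_reduce
    generalize cos (2 * th (s * t)) = C at *
    generalize sin (2 * th (s * t)) = S at *
    generalize sg (s * t) = G at *
    generalize et (s * t) = E at *
    generalize th (s * t) - th 0 = D at *
    have m1 := le_max_left |D| |E|
    have m2 := le_max_right |D| |E|
    generalize max |D| |E| = M at *
    have hM : 0 ≤ M := (abs_nonneg _).trans m1
    have sM : |S| ≤ 2 * M := by linarith
  · have t1 : |-C * E| ≤ 1 * M := by rw [abs_mul, abs_neg]; gcongr
    have t2 : |S * G| ≤ 2 * M * A := by rw [abs_mul]; gcongr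
    have := abs_add_le (-C * E) (S * G)
    nlinarith [mul_nonneg (sq_nonneg A) hM, mul_nonneg (sq_nonneg B) hM]
  · have t1 : |-S * E ^ 2| ≤ 2 * M * B ^ 2 := by rw [abs_mul, abs_neg, abs_pow]; gcongr
    have t2 : |S * G ^ 2| ≤ 2 * M * A ^ 2 := by rw [abs_mul, abs_pow]; gcongr
    have t3 : |2 * C * G * E| ≤ 2 * 1 * A * M := by
      rw [abs_mul, abs_mul, abs_mul, abs_two]; gcongr
    have := abs_add_le (-S * E ^ 2) (S * G ^ 2)
    have := norm_sub_le (-S * E ^ 2 + S * G ^ 2) (2 * C * G * E)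
    simp only [Real.norm_eq_abs] at this
    nlinarith
end

section
/- If a solution of the system on an interval I ⊆ ℝ containing 0 satisfies cos(2θ(0)) = 0 and σ(0) = 0, then σ(s) = 0 and cos(2θ(s)) = 0 for all s ∈ I; in fact θ(s) = θ(0) for all s ∈ I. (Thus the radial set R = {cos(2θ) = 0, σ = 0} is invariant under the flow.) -/
open Real

theorem aux_forward (I : Set ℝ) (hI : I.OrdConnected) (h0 : (0 : ℝ) ∈ I)
    (f f' e : ℝ → ℝ) (hf : ∀ s ∈ I, HasDerivWithinAt f (f' s) I s)
    (he : ContinuousOn e I) (hf0 : f 0 = 0)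
    (hb : ∀ s ∈ I, |f' s| ≤ |e s| * |f s|) (b : ℝ) (hbI : b ∈ I) (hb0 : 0 ≤ b) :
    f b = 0 := by
  have hsub : Set.Icc 0 b ⊆ I := hI.out h0 hbI
  obtain ⟨M, hM⟩ := isCompact_Icc.exists_bound_of_continuousOn (he.mono hsub)
  refine eq_zero_of_abs_deriv_le_mul_abs_self_of_eq_zero_right (f := f) (f' := f') (K := M)
    (a := 0) (b := b) (fun x hx => ((hf x (hsub hx)).continuousWithinAt).mono hsub) ?_ hf0 ?_
    b ⟨hb0, le_rfl⟩
  · intro x hx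
    refine (hf x (hsub ⟨hx.1, hx.2.le⟩)).mono_of_mem_nhdsWithin ?_
    refine Filter.mem_of_superset (Icc_mem_nhdsGE hx.2) ?_
    exact fun y hy => hsub ⟨hx.1.trans hy.1, hy.2⟩
  · intro x hx
    have hx' : x ∈ Set.Icc 0 b := ⟨hx.1, hx.2.le⟩
    exact (hb x (hsub hx')).trans (mul_le_mul_of_nonneg_right (hM x hx') (abs_nonneg _))

theorem aux_both (I : Set ℝ) (hI : I.OrdConnected) (h0 : (0 : ℝ) ∈ I)
    (f f' e : ℝ → ℝ) (hf : ∀ s ∈ I, HasDerivWithinAt f (f' s) I s)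
    (he : ContinuousOn e I) (hf0 : f 0 = 0)
    (hb : ∀ s ∈ I, |f' s| ≤ |e s| * |f s|) (b : ℝ) (hbI : b ∈ I) :
    f b = 0 := by
  rcases le_total 0 b with h | h
  · exact aux_forward I hI h0 f f' e hf he hf0 hb b hbI h
  · have key := aux_forward ((fun x : ℝ => -x) ⁻¹' I)
      ⟨fun x hx y hy z hz => hI.out hy hx ⟨neg_le_neg hz.2, neg_le_neg hz.1⟩⟩
      (by simpa using h0) (fun x => f (-x)) (fun x => f' (-x) * (-1)) (fun x => e (-x))
      (fun s hs => (hf (-s) hs).comp s (hasDerivAt_neg s).hasDerivWithinAt (fun x hx => hx))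
      (he.comp continuous_neg.continuousOn (fun x hx => hx)) (by simpa using hf0)
      (fun s hs => by simpa using hb (-s) hs) (-b) (by simpa using hbI) (by linarith)
    simpa using key

/-- Invariance of the radial set `R = {cos(2θ) = 0, σ = 0}` under the rescaled
Hamiltonian flow: a solution starting on `R` stays on `R`, with `θ` constant. -/
theorem radial_set_invariant
    (h : ℝ) (I : Set ℝ) (hI : I.OrdConnected) (h0 : (0 : ℝ) ∈ I)
    (tau th sg et : ℝ → ℝ)
    (htau : ∀ s ∈ I, HasDerivWithinAt tau
      (tau s * (cos (2 * th s) * sg s + sin (2 * th s) * et s)) I s)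
    (hth : ∀ s ∈ I, HasDerivWithinAt th
      (-cos (2 * th s) * et s + sin (2 * th s) * sg s) I s)
    (hsg : ∀ s ∈ I, HasDerivWithinAt sg 0 I s)
    (het : ∀ s ∈ I, HasDerivWithinAt et
      (-sin (2 * th s) * et s ^ 2 + sin (2 * th s) * sg s ^ 2
        - 2 * cos (2 * th s) * sg s * et s) I s)
    (hcos0 : cos (2 * th 0) = 0) (hsg0 : sg 0 = 0) :
    ∀ s ∈ I, sg s = 0 ∧ cos (2 * th s) = 0 ∧ th s = th 0 := by
  have hsgz : ∀ s ∈ I, sg s = 0 := fun s hs =>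
    aux_both I hI h0 sg (fun _ => 0) (fun _ => 0) hsg continuousOn_const hsg0 (by simp) s hs
  have hthc : ∀ s ∈ I, th s - th 0 = 0 := by
    intro s hs
    refine aux_both I hI h0 (fun s => th s - th 0) _ (fun s => 2 * et s)
      (fun s hs => (hth s hs).sub_const _)
      (continuousOn_const.mul fun s hs => (het s hs).continuousWithinAt) (by simp) ?_ s hs
    intro s hs
    have h1 : |cos (2 * th s)| ≤ 2 * |th s - th 0| := by
      have h2 := abs_cos_sub_cos_le (2 * th s) (2 * th 0)
      rw [hcos0, sub_zero, ← mul_sub, abs_mul, abs_two] at h2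
      exact h2
    rw [hsgz s hs, mul_zero, add_zero, abs_mul, abs_neg, abs_mul, abs_two]
    nlinarith [mul_le_mul_of_nonneg_right h1 (abs_nonneg (et s))]
  intro s hs
  have h3 : th s = th 0 := sub_eq_zero.mp (hthc s hs)
  exact ⟨hsgz s hs, by rw [h3, hcos0], h3⟩
end
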